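/- Let n ≥ 3 and d = ⌊(n−2)/2⌋. Let H = (H_{ik})_{1≤i,k≤n} be a matrix of real polynomial functions on ℝⁿ, each entry having zero constant term and degree at most d, satisfying: H_{ik} = H_{ki} for all i,k; Σ_{i=1}^n H_{ii} = 0 identically; ∂_a H_{bc}(0) = 0 for all a,b,c ∈ {1,…,n−1}; H_{in}(x) = 0 for all i ∈ {1,…,n} and all x ∈ ℝⁿ₊; and Σ_{a=1}^{n−1} x_a H_{ab}(x) = 0 for all b ∈ {1,…,n−1} and all x ∈ ∂ℝⁿ₊. Define A_{ij} = Σ_m ∂_i∂_m H_{mj} + Σ_m ∂_m∂_j H_{im} − Δ H_{ij} − (1/(n−1)) Σ_{m,p} ∂_m∂_p H_{mp} δ_{ij}, and Z_{ijkl} = ∂_i∂_k H_{jl} − ∂_i∂_l H_{jk} − ∂_j∂_k H_{il} + ∂_j∂_l H_{ik} + (1/(n−2))(A_{jl}δ_{ik} − A_{jk}δ_{il} − A_{il}δ_{jk} + A_{ik}δ_{jl}). If Z_{ijkl}(x) = 0 for all i,j,k,l and all x ∈ ℝⁿ₊, and ∂_n H_{ij}(x) = 0 for all i,j and all x ∈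 ∂ℝⁿ₊, then H(x) = 0 for all x ∈ ℝⁿ₊. -/

import Mathlib

open MvPolynomial

/-- The algebraic Schouten tensor
`A_{ij} = ∂_i∂_m H_{mj} + ∂_m∂_j H_{im} − Δ H_{ij} − (1/(n−1)) ∂_m∂_p H_{mp} δ_{ij}`
(summation over repeated indices). -/
noncomputable def algSchouten (n : ℕ) (H : Fin n → Fin n → MvPolynomial (Fin n) ℝ)
    (i j : Fin n) : MvPolynomial (Fin n) ℝ :=
  (∑ m, pderiv i (pderiv m (H m j))) + (∑ m, pderiv m (pderiv j (H i m)))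
    - (∑ m, pderiv m (pderiv m (H i j)))
    - C (((n : ℝ) - 1)⁻¹) * (if i = j then ∑ m, ∑ p, pderiv m (pderiv p (H m p)) else 0)

/-- The algebraic Weyl tensor
`Z_{ijkl} = ∂_i∂_k H_{jl} − ∂_i∂_l H_{jk} − ∂_j∂_k H_{il} + ∂_j∂_l H_{ik}
  + (1/(n−2))(A_{jl}δ_{ik} − A_{jk}δ_{il} − A_{il}δ_{jk} + A_{ik}δ_{jl})`. -/
noncomputable def algWeyl (n : ℕ) (H : Fin n → Fin n → MvPolynomial (Fin n) ℝ)
    (i j k l : Fin n) : MvPolynomial (Fin n) ℝ :=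
  pderiv i (pderiv k (H j l)) - pderiv i (pderiv l (H j k))
    - pderiv j (pderiv k (H i l)) + pderiv j (pderiv l (H i k))
    + C (((n : ℝ) - 2)⁻¹) *
      ((if i = k then algSchouten n H j l else 0) - (if i = l then algSchouten n H j k else 0)
        - (if j = k then algSchouten n H i l else 0) + (if j = l then algSchouten n H i k else 0))


section WeylHelpers

variable {m : ℕ}

/-- Euler operator. -/
noncomputable def eul (p : MvPolynomial (Fin m) ℝ) : MvPolynomial (Fin m) ℝ :=
  ∑ i, X i * pderiv i p

theorem eul_add (p q : MvPolynomial (Fin m) ℝ) : eul (p + q) = eul p + eul q := by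
  simp [eul, mul_add, Finset.sum_add_distrib]

theorem coeff_eul (p : MvPolynomial (Fin m) ℝ) (d : Fin m →₀ ℕ) :
    coeff d (eul p) = (d.degree : ℝ) * coeff d p := by
  induction p using MvPolynomial.induction_on' with
  | add p q hp hq => rw [eul_add, coeff_add, coeff_add, hp, hq, mul_add]
  | monomial e a =>
    unfold eul
    simp_rw [X_mul_pderiv_monomial]
    rw [← Finset.sum_smul, coeff_smul, coeff_monomial, Finsupp.degree_eq_sum]
    split_ifs with h
    · subst h; simp
    · simp

theorem pderiv_comm' {n : ℕ} (a b : Fin n) (p : MvPolynomial (Fin n) ℝ) :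
    pderiv a (pderiv b p) = pderiv b (pderiv a p) := by
  ext d
  simp only [coeff_pderiv]
  rw [add_right_comm]
  by_cases h : a = b
  · subst h; rfl
  · have h' : b ≠ a := fun e => h e.symm
    simp [h, h']; ring

theorem pderiv_eul (a : Fin m) (p : MvPolynomial (Fin m) ℝ) :
    pderiv a (eul p) = eul (pderiv a p) + pderiv a p := by
  ext d
  simp only [coeff_pderiv, coeff_add, coeff_eul]
  simp
  ring

theorem pderiv_sumX (a : Fin m) (f : Fin m → MvPolynomial (Fin m) ℝ) :
    pderiv a (∑ c, X c * f c) = f a + ∑ c, X c * pderiv a (f c) := by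
  simp [Finset.sum_add_distrib, pderiv_X, Pi.single_apply, add_comm]

theorem eul_inj (p : MvPolynomial (Fin m) ℝ) (k : ℝ) (hk : 0 < k) (h : eul p + C k * p = 0) :
    p = 0 := by
  ext d
  have := congrArg (coeff d) h
  simp only [coeff_add, coeff_eul, coeff_C_mul, coeff_zero] at this ⊢
  have h2 : ((d.degree : ℝ) + k) * coeff d p = 0 := by linarith
  rcases mul_eq_zero.1 h2 with h3 | h3
  · have : (0:ℝ) ≤ d.degree := by positivity
    linarith
  · exact h3

theorem eul_zero_const (p : MvPolynomial (Fin m) ℝ) (h : eul p = 0) (h0 : coeff 0 p = 0) :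
    p = 0 := by
  ext d
  have := congrArg (coeff d) h
  simp only [coeff_eul, coeff_zero] at this ⊢
  rcases mul_eq_zero.1 this with h3 | h3
  · have : d = 0 := by
      rw [Nat.cast_eq_zero] at h3
      exact (Finsupp.degree_eq_zero_iff d).1 h3
    rw [this, h0]
  · exact h3

/-- `|x|^2`. -/
noncomputable def rsq (m : ℕ) : MvPolynomial (Fin m) ℝ := ∑ i, X i * X i

/-- Laplacian. -/
noncomputable def lap (p : MvPolynomial (Fin m) ℝ) : MvPolynomial (Fin m) ℝ :=
  ∑ i, pderiv i (pderiv i p)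

theorem pderiv_rsq (a : Fin m) : pderiv a (rsq m) = 2 * X a := by
  unfold rsq
  rw [pderiv_sumX]
  simp [pderiv_X, Pi.single_apply]; ring

theorem lap_rsq_mul (p : MvPolynomial (Fin m) ℝ) :
    lap (rsq m * p) = C (2 * (m : ℝ)) * p + C 4 * eul p + rsq m * lap p := by
  have h : ∀ i : Fin m, pderiv i (pderiv i (rsq m * p)) =
      2 * p + 4 * (X i * pderiv i p) + rsq m * pderiv i (pderiv i p) := by
    intro i
    have h2 : pderiv i (2 : MvPolynomial (Fin m) ℝ) = 0 := by
      have := pderiv_C (R := ℝ) (σ := Fin m) (a := 2) (i := i)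
      rwa [map_ofNat] at this
    rw [pderiv_mul, pderiv_rsq, map_add, pderiv_mul, pderiv_mul, pderiv_mul, pderiv_rsq, h2,
      pderiv_X_self]
    ring
  unfold lap eul
  simp_rw [h, Finset.sum_add_distrib, ← Finset.mul_sum]
  have e4 : (C 4 : MvPolynomial (Fin m) ℝ) = 4 := map_ofNat C 4
  have e2 : (C 2 : MvPolynomial (Fin m) ℝ) = 2 := map_ofNat C 2
  rw [map_mul, e4, e2]
  simp
  ring

theorem hc_pderiv (j : ℕ) (i : Fin m) (p : MvPolynomial (Fin m) ℝ) :
    homogeneousComponent j (pderiv i p) = pderiv i (homogeneousComponent (j + 1) p) := by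
  ext d
  rw [coeff_homogeneousComponent, coeff_pderiv, coeff_pderiv, coeff_homogeneousComponent]
  simp

theorem hc_X_mul (j : ℕ) (i : Fin m) (p : MvPolynomial (Fin m) ℝ) :
    homogeneousComponent (j + 1) (X i * p) = X i * homogeneousComponent j p := by
  ext d
  rw [coeff_homogeneousComponent, coeff_X_mul', coeff_X_mul', coeff_homogeneousComponent]
  by_cases h : i ∈ d.support
  · obtain ⟨e, rfl⟩ : ∃ e, d = e + Finsupp.single i 1 := by
      refine ⟨d - Finsupp.single i 1, ?_⟩
      rw [Finsupp.sub_add_single_one_cancel]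
      simpa using h
    simp
  · simp [h]

theorem hc_eul (j : ℕ) (p : MvPolynomial (Fin m) ℝ) :
    homogeneousComponent j (eul p) = C (j : ℝ) * homogeneousComponent j p := by
  ext d
  rw [coeff_C_mul, coeff_homogeneousComponent, coeff_homogeneousComponent, coeff_eul]
  split_ifs with h
  · rw [h]
  · simp

theorem eul_hom (j : ℕ) (p : MvPolynomial (Fin m) ℝ) (hp : p.IsHomogeneous j) :
    eul p = C (j : ℝ) * p := by
  unfold eul
  rw [hp.sum_X_mul_pderiv]
  simp

theorem hc_rsq_lap (j : ℕ) (p : MvPolynomial (Fin m) ℝ) :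
    homogeneousComponent j (rsq m * lap p) = rsq m * lap (homogeneousComponent j p) := by
  match j with
  | 0 =>
    rw [homogeneousComponent_zero, homogeneousComponent_zero]
    simp [lap, rsq, ← constantCoeff_eq]
  | 1 =>
    have h1 : lap (homogeneousComponent 1 p) = 0 := by
      unfold lap
      simp_rw [← hc_pderiv, homogeneousComponent_zero]
      simp
    rw [h1, rsq, Finset.sum_mul, map_sum]
    simp_rw [mul_assoc, hc_X_mul, homogeneousComponent_zero]
    simp [← constantCoeff_eq]
  | j + 2 =>
    simp only [rsq, lap, Finset.sum_mul, map_sum, mul_assoc, hc_X_mul, hc_pderiv]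

theorem lap_hom (j : ℕ) (p : MvPolynomial (Fin m) ℝ) (hp : p.IsHomogeneous (j + 2)) :
    (lap p).IsHomogeneous j := by
  rw [← homogeneousComponent_eq_self hp]
  unfold lap
  simp_rw [← hc_pderiv, ← map_sum]
  exact homogeneousComponent_isHomogeneous _ _

theorem lap_C_mul (c : ℝ) (p : MvPolynomial (Fin m) ℝ) : lap (C c * p) = C c * lap p := by
  unfold lap
  simp_rw [pderiv_C_mul, Finset.mul_sum]

theorem hom_vanish (k : ℕ) : ∀ (c : ℝ) (_ : 0 < c) (T : MvPolynomial (Fin m) ℝ)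
    (_ : T.IsHomogeneous k) (_ : rsq m * lap T + C c * T = 0), T = 0 := by
  induction k using Nat.strong_induction_on with
  | _ k ih =>
  intro c hc T hT h
  have key : ∀ S : MvPolynomial (Fin m) ℝ, C c * S = 0 → S = 0 := by
    intro S hS
    rcases mul_eq_zero.1 hS with h | h
    · rw [C_eq_zero] at h; exact absurd h hc.ne'
    · exact h
  by_cases hk : k < 2
  · apply key
    have : lap T = 0 := by
      rw [← homogeneousComponent_eq_self hT]
      unfold lap
      interval_cases k
      · simp_rw [homogeneousComponent_zero]; simp
      · simp_rw [← hc_pderiv, homogeneousComponent_zero]; simp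
    rw [this] at h
    simpa using h
  · obtain ⟨j, rfl⟩ : ∃ j, k = j + 2 := ⟨k - 2, by omega⟩
    have hψ := lap_hom j T hT
    have hz : lap T = 0 := by
      refine ih j (by omega) (c + 2 * m + 4 * j) (by positivity) _ hψ ?_
      have h1 : C c * T = - (rsq m * lap T) := by linear_combination h
      have h2 : C c * lap T = - lap (rsq m * lap T) := by
        rw [← lap_C_mul, h1]; unfold lap; simp only [map_neg, Finset.sum_neg_distrib]
      rw [lap_rsq_mul, eul_hom j _ hψ] at h2
      simp only [map_add, map_mul, map_natCast] at h2 ⊢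
      linear_combination h2
    apply key
    rw [hz] at h
    simpa using h

theorem scal_vanish (T : MvPolynomial (Fin m) ℝ) (hm : 2 ≤ m)
    (h : lap (rsq m * T) + C ((m : ℝ) - 2) * (eul (eul T) + 3 * eul T + 2 * T) = 0) : T = 0 := by
  have h0 : ∀ j, homogeneousComponent j T = 0 := by
    intro j
    have h1 := congrArg (homogeneousComponent j) h
    have e3 : (3 : MvPolynomial (Fin m) ℝ) = C 3 := (map_ofNat C 3).symm
    have e2 : (2 : MvPolynomial (Fin m) ℝ) = C 2 := (map_ofNat C 2).symm
    rw [lap_rsq_mul, e3, e2] at h1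
    simp only [map_add, homogeneousComponent_C_mul, hc_eul, hc_rsq_lap, map_zero] at h1
    have hm' : (0:ℝ) ≤ (m:ℝ) - 2 := by
      have : (2:ℝ) ≤ m := by exact_mod_cast hm
      linarith
    have hmp : (0:ℝ) < m := by
      have : (2:ℝ) ≤ m := by exact_mod_cast hm
      linarith
    refine hom_vanish j (2 * m + 4 * j + (m - 2) * (j * j + 3 * j + 2)) (by positivity) _
      (homogeneousComponent_isHomogeneous _ _) ?_
    simp only [map_add, map_mul] at h1 ⊢
    linear_combination h1
  rw [← sum_homogeneousComponent T]
  simp [h0]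

end WeylHelpers

section WeylHelpers2

variable {m : ℕ}

theorem exists_ne3 (hm : 4 ≤ m) (e b d : Fin m) : ∃ a : Fin m, a ≠ e ∧ a ≠ b ∧ a ≠ d := by
  by_contra hcon
  push Not at hcon
  have hsub : (Finset.univ : Finset (Fin m)) ⊆ {e, b, d} := by
    intro a _
    simp only [Finset.mem_insert, Finset.mem_singleton]
    by_cases h1 : a = e
    · exact Or.inl h1
    · by_cases h2 : a = b
      · exact Or.inr (Or.inl h2)
      · exact Or.inr (Or.inr (hcon a h1 h2))
  have h1 := Finset.card_le_card hsub
  have h2 := Finset.card_le_three (a := e) (b := b) (c := d)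
  simp at h1
  omega

theorem two_eq_zero' (p : MvPolynomial (Fin m) ℝ) (h : p = -p) : p = 0 := by
  ext d
  have := congrArg (coeff d) h
  rw [coeff_neg] at this
  rw [coeff_zero]
  linarith

/-- Second Bianchi identity gives the Codazzi equation. -/
theorem codazzi (hm : 4 ≤ m) (h P : Fin m → Fin m → MvPolynomial (Fin m) ℝ)
    (hR : ∀ a b c d, pderiv a (pderiv c (h b d)) - pderiv a (pderiv d (h b c))
      - pderiv b (pderiv c (h a d)) + pderiv b (pderiv d (h a c)) =
      (if a = c then P b d else 0) - (if a = d then P b c else 0)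
        - (if b = c then P a d else 0) + (if b = d then P a c else 0)) :
    ∀ a b c, pderiv a (P b c) = pderiv b (P a c) := by
  set Q : Fin m → Fin m → Fin m → MvPolynomial (Fin m) ℝ :=
    fun a b c => pderiv a (P b c) - pderiv b (P a c) with hQ
  have hQs : ∀ a b c, Q a b c = - Q b a c := by intro a b c; simp only [hQ]; ring
  have dite : ∀ (e : Fin m) (p : Prop) [Decidable p] (q : MvPolynomial (Fin m) ℝ),
      pderiv e (if p then q else 0) = if p then pderiv e q else 0 := by
    intro e p _ q
    split_ifs <;> simp
  have bian : ∀ e a b c d, 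
      pderiv e (pderiv a (pderiv c (h b d)) - pderiv a (pderiv d (h b c))
      - pderiv b (pderiv c (h a d)) + pderiv b (pderiv d (h a c))) +
      pderiv a (pderiv b (pderiv c (h e d)) - pderiv b (pderiv d (h e c))
      - pderiv e (pderiv c (h b d)) + pderiv e (pderiv d (h b c))) +
      pderiv b (pderiv e (pderiv c (h a d)) - pderiv e (pderiv d (h a c))
      - pderiv a (pderiv c (h e d)) + pderiv a (pderiv d (h e c))) = 0 := by
    intro e a b c d
    simp only [map_add, map_sub]
    rw [pderiv_comm' e a (pderiv c (h b d)), pderiv_comm' e a (pderiv d (h b c)),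
      pderiv_comm' e b (pderiv c (h a d)), pderiv_comm' e b (pderiv d (h a c)),
      pderiv_comm' a b (pderiv c (h e d)), pderiv_comm' a b (pderiv d (h e c))]
    ring
  have key : ∀ e b d a, a ≠ e → a ≠ b → a ≠ d →
      Q e b d = (if b = d then Q a e a else 0) + (if e = d then Q b a a else 0) := by
    intro e b d a h1 h2 h3
    have := bian e a b a d
    simp only [hR, map_add, map_sub, dite] at this
    simp only [if_true, h3, if_false, h1.symm, h2.symm] at this
    simp only [hQ]
    split_ifs at this ⊢ <;> linear_combination this
  have key2 : ∀ e b, e ≠ b → Q e b b = 0 := by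
    intro e b heb
    obtain ⟨a, ha1, ha2, -⟩ := exists_ne3 hm e b b
    obtain ⟨c, hc1, hc2, hc3⟩ := exists_ne3 hm e b a
    have k1 := key e b b a ha1 ha2 ha2
    have k2 := key e b b c hc1 hc2 hc2
    have k3 := key e a a c hc1 hc3 hc3
    simp only [if_true, heb, if_false, ha1.symm, add_zero] at k1 k2 k3
    apply two_eq_zero'
    rw [hQs a e a] at k1
    calc Q e b b = - Q e a a := k1
      _ = - Q e b b := by rw [k3, k2]
  intro a b c
  rw [← sub_eq_zero]
  change Q a b c = 0
  by_cases hab : a = b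
  · subst hab; simp [hQ]
  by_cases hbc : b = c
  · subst hbc; exact key2 a b hab
  by_cases hac : a = c
  · subst hac; rw [hQs, key2 b a (Ne.symm hab), neg_zero]
  obtain ⟨e, he1, he2, he3⟩ := exists_ne3 hm a b c
  rw [key a b c e he1 he2 he3]
  simp [hbc, hac]

theorem sum_X_dd (f : Fin m → MvPolynomial (Fin m) ℝ) (a d : Fin m)
    (hf : ∑ c, X c * f c = 0) :
    ∑ c, X c * pderiv a (pderiv d (f c)) = - pderiv a (f d) - pderiv d (f a) := by
  have h1 := pderiv_sumX d f
  rw [hf, map_zero] at h1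
  have h2 := pderiv_sumX a (fun c => pderiv d (f c))
  have h3 : ∑ c, X c * pderiv d (f c) = - f d := by linear_combination -h1
  rw [h3, map_neg] at h2
  linear_combination -h2

theorem eul_two (p : MvPolynomial (Fin m) ℝ) (h : eul (eul p) + 3 * eul p + 2 * p = 0) :
    p = 0 := by
  have e2 : (C 2 : MvPolynomial (Fin m) ℝ) = 2 := map_ofNat C 2
  have e1 : (C 1 : MvPolynomial (Fin m) ℝ) = 1 := map_one C
  have hq : eul p + C 1 * p = 0 := by
    apply eul_inj _ 2 (by norm_num)
    rw [e1, one_mul, eul_add, e2]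
    linear_combination h
  exact eul_inj p 1 one_pos hq

set_option maxHeartbeats 2000000 in
theorem flat_vanish (hm : 4 ≤ m) (h P : Fin m → Fin m → MvPolynomial (Fin m) ℝ)
    (hconst : ∀ a b, coeff 0 (h a b) = 0)
    (hs : ∀ a b, h a b = h b a) (hPs : ∀ a b, P a b = P b a)
    (htr : ∑ a, h a a = 0) (hx : ∀ b, ∑ a, X a * h a b = 0)
    (hR : ∀ a b c d, pderiv a (pderiv c (h b d)) - pderiv a (pderiv d (h b c))
      - pderiv b (pderiv c (h a d)) + pderiv b (pderiv d (h a c)) =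
      (if a = c then P b d else 0) - (if a = d then P b c else 0)
        - (if b = c then P a d else 0) + (if b = d then P a c else 0)) :
    ∀ a b, h a b = 0 := by
  have cod := codazzi hm h P hR
  have hx' : ∀ b, ∑ c, X c * h b c = 0 := by
    intro b; rw [← hx b]; simp_rw [hs b]
  -- first contraction
  have c1 : ∀ a b d, pderiv a (eul (h b d)) - pderiv b (eul (h a d)) =
      X a * P b d - (if a = d then ∑ c, X c * P b c else 0) - X b * P a d
        + (if b = d then ∑ c, X c * P a c else 0) := by
    intro a b d
    have hsum : ∑ c, X c * (pderiv a (pderiv c (h b d)) - pderiv a (pderiv d (h b c))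
      - pderiv b (pderiv c (h a d)) + pderiv b (pderiv d (h a c))) =
      ∑ c, X c * ((if a = c then P b d else 0) - (if a = d then P b c else 0)
        - (if b = c then P a d else 0) + (if b = d then P a c else 0)) :=
      Finset.sum_congr rfl fun c _ => by rw [hR]
    simp only [mul_add, mul_sub, Finset.sum_add_distrib, Finset.sum_sub_distrib] at hsum
    rw [sum_X_dd _ a d (hx' b), sum_X_dd _ b d (hx' a)] at hsum
    have e1 : ∀ a p, ∑ c, X c * pderiv a (pderiv c p) =
        pderiv a (eul p) - pderiv a (p : MvPolynomial (Fin m) ℝ) := by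
      intro a p
      unfold eul
      rw [pderiv_sumX]; ring
    rw [e1, e1] at hsum
    have e2 : ∀ a (q : MvPolynomial (Fin m) ℝ),
        ∑ c, X c * (if a = c then q else 0) = X a * q := by
      intro a q; simp
    have e3 : ∀ a (f : Fin m → MvPolynomial (Fin m) ℝ),
        ∑ c, X c * (if a = d then f c else 0) = if a = d then ∑ c, X c * f c else 0 := by
      intro a f; split_ifs <;> simp
    rw [e2, e2, e3, e3, hs b a] at hsum
    linear_combination hsum
  set v : Fin m → MvPolynomial (Fin m) ℝ := fun b => ∑ c, X c * P b c with hv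
  set φ : MvPolynomial (Fin m) ℝ := ∑ a, X a * v a with hφ
  -- second contraction
  have hG : ∀ d, ∑ a, X a * eul (h a d) = 0 := by
    intro d
    have h1 : ∑ a, X a * eul (h a d) = ∑ c, X c * ∑ a, X a * pderiv c (h a d) := by
      unfold eul
      simp_rw [Finset.mul_sum]
      rw [Finset.sum_comm]
      refine Finset.sum_congr rfl fun c _ => Finset.sum_congr rfl fun a _ => by ring
    have h2 : ∀ c, ∑ a, X a * pderiv c (h a d) = - h c d := by
      intro c
      have := pderiv_sumX c (fun a => h a d)
      rw [hx, map_zero] at this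
      linear_combination -this
    rw [h1]
    simp_rw [h2, mul_neg, Finset.sum_neg_distrib, hx, neg_zero]
  have c2 : ∀ b d, eul (eul (h b d)) + eul (h b d) =
      rsq m * P b d - X d * v b - X b * v d + (if b = d then φ else 0) := by
    intro b d
    have hsum : ∑ a, X a * (pderiv a (eul (h b d)) - pderiv b (eul (h a d))) =
      ∑ a, X a * (X a * P b d - (if a = d then v b else 0) - X b * P a d
        + (if b = d then v a else 0)) :=
      Finset.sum_congr rfl fun a _ => by rw [c1]
    simp only [mul_add, mul_sub, Finset.sum_add_distrib, Finset.sum_sub_distrib] at hsum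
    have h1 : ∑ a, X a * pderiv b (eul (h a d)) = - eul (h b d) := by
      have := pderiv_sumX b (fun a => eul (h a d))
      rw [hG, map_zero] at this
      linear_combination -this
    have h2 : ∑ a, X a * (if b = d then v a else 0) = if b = d then φ else 0 := by
      split_ifs <;> simp [hφ]
    have h3 : ∑ a, X a * (if a = d then v b else 0) = X d * v b := by simp
    have h4 : ∑ a, X a * (X b * P a d) = X b * v d := by
      rw [hv]; simp only [Finset.mul_sum]
      exact Finset.sum_congr rfl fun a _ => by rw [hPs d a]; ring
    have h5 : ∑ a, X a * (X a * P b d) = rsq m * P b d := by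
      rw [rsq, Finset.sum_mul]
      exact Finset.sum_congr rfl fun a _ => by ring
    rw [h1, h2, h3, h4, h5] at hsum
    change eul (eul (h b d)) - _ = _ at hsum
    linear_combination hsum
  set T : MvPolynomial (Fin m) ℝ := ∑ a, P a a with hT
  have eul_sum : ∀ f : Fin m → MvPolynomial (Fin m) ℝ, ∑ a, eul (f a) = eul (∑ a, f a) := by
    intro f
    unfold eul
    simp_rw [map_sum, Finset.mul_sum]
    exact Finset.sum_comm
  have eul0 : eul (0 : MvPolynomial (Fin m) ℝ) = 0 := by simp [eul]
  have c3 : rsq m * T + ((m : MvPolynomial (Fin m) ℝ) - 2) * φ = 0 := by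
    have hsum : ∑ b, (eul (eul (h b b)) + eul (h b b)) =
      ∑ b, (rsq m * P b b - X b * v b - X b * v b + (if b = b then φ else 0)) :=
      Finset.sum_congr rfl fun a _ => by rw [c2]
    simp only [Finset.sum_add_distrib, Finset.sum_sub_distrib, eul_sum, htr, eul0, if_true,
      ← Finset.mul_sum, Finset.sum_const, Finset.card_univ, Fintype.card_fin, nsmul_eq_mul,
      add_zero] at hsum
    linear_combination -hsum
  -- hessian of φ
  have dv : ∀ a b, pderiv a (v b) = eul (P b a) + P b a := by
    intro a b
    rw [hv]
    simp only
    rw [pderiv_sumX, add_comm]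
    congr 1
    unfold eul
    exact Finset.sum_congr rfl fun c _ => by rw [hPs b c, cod a c b, hPs a b]
  have dφ : ∀ a, pderiv a φ = eul (v a) + v a := by
    intro a
    rw [hφ, pderiv_sumX, add_comm]
    congr 1
    unfold eul
    refine Finset.sum_congr rfl fun c _ => ?_
    rw [dv, dv, hPs]
  have hess : ∀ a b, pderiv b (pderiv a φ) = eul (eul (P a b)) + 3 * eul (P a b) + 2 * P a b := by
    intro a b
    rw [dφ, map_add, pderiv_eul, dv, eul_add]
    ring
  have hlap : lap φ = eul (eul T) + 3 * eul T + 2 * T := by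
    rw [hT]
    unfold lap
    simp_rw [hess, Finset.sum_add_distrib, ← Finset.mul_sum, eul_sum]
  have hCm : (C ((m : ℝ) - 2) : MvPolynomial (Fin m) ℝ) = (m : MvPolynomial (Fin m) ℝ) - 2 := by
    rw [map_sub, map_natCast, map_ofNat]
  have hT0 : T = 0 := by
    apply scal_vanish T (by omega)
    have h1 : rsq m * T = C (-((m : ℝ) - 2)) * φ := by
      rw [map_neg, hCm]; linear_combination c3
    rw [h1, lap_C_mul, hlap, map_neg]
    ring
  have hφ0 : φ = 0 := by
    rw [hT0, mul_zero, zero_add, ← hCm] at c3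
    rcases mul_eq_zero.1 c3 with h1 | h1
    · rw [C_eq_zero] at h1
      have : (4 : ℝ) ≤ m := by exact_mod_cast hm
      linarith
    · exact h1
  have hP0 : ∀ a b, P a b = 0 := by
    intro a b
    apply eul_two
    rw [← hess, hφ0]; simp
  have hv0 : ∀ a, v a = 0 := by
    intro a; simp [hv, hP0]
  intro a b
  have h1 := c2 a b
  rw [hP0, hv0, hv0, hφ0] at h1
  apply eul_zero_const _ _ (hconst a b)
  apply eul_inj _ 1 one_pos
  rw [map_one, one_mul, h1]
  simp

end WeylHelpers2

section WeylHelpers3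

variable {m : ℕ}

/-- Restriction to the boundary. -/
noncomputable def bdr (m : ℕ) : MvPolynomial (Fin (m + 1)) ℝ →ₐ[ℝ] MvPolynomial (Fin m) ℝ :=
  aeval (fun i => Fin.lastCases (motive := fun _ => MvPolynomial (Fin m) ℝ) 0 X i)

theorem bdr_last : bdr m (X (Fin.last m)) = 0 := by simp [bdr]

theorem bdr_cast (a : Fin m) : bdr m (X a.castSucc) = X a := by simp [bdr]

theorem bdr_C (c : ℝ) : bdr m (C c) = C c := by simp [bdr]

theorem bdr_pderiv (a : Fin m) (p : MvPolynomial (Fin (m + 1)) ℝ) :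
    bdr m (pderiv a.castSucc p) = pderiv a (bdr m p) := by
  induction p using MvPolynomial.induction_on with
  | C c => simp [bdr_C]
  | add p q hp hq => simp [hp, hq]
  | mul_X p i hp =>
    rw [pderiv_mul, map_add, map_mul, map_mul, map_mul, pderiv_mul, hp]
    congr 2
    refine Fin.lastCases ?_ (fun b => ?_) i
    · rw [bdr_last, pderiv_X_of_ne (Fin.castSucc_lt_last a).ne']; simp
    · rw [bdr_cast, pderiv_X, pderiv_X]
      by_cases h : b = a
      · subst h; simp
      · simp [h]

theorem eval_bdr (y : Fin m → ℝ) (p : MvPolynomial (Fin (m + 1)) ℝ) :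
    eval y (bdr m p) = eval (Fin.snoc (α := fun _ => ℝ) y 0) p := by
  induction p using MvPolynomial.induction_on with
  | C c => simp [bdr_C]
  | add p q hp hq => simp [hp, hq]
  | mul_X p i hp =>
    rw [map_mul, map_mul, map_mul, hp]
    congr 1
    refine Fin.lastCases ?_ (fun b => ?_) i
    · rw [bdr_last]; simp
    · rw [bdr_cast]; simp

theorem coeff_ren_bdr (p : MvPolynomial (Fin (m + 1)) ℝ) :
    ∀ d : Fin (m + 1) →₀ ℕ, d (Fin.last m) = 0 →
      coeff d (rename Fin.castSucc (bdr m p)) = coeff d p := by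
  induction p using MvPolynomial.induction_on with
  | C c => intro d hd; simp [bdr_C]
  | add p q hp hq => intro d hd; simp [hp d hd, hq d hd]
  | mul_X p i hp =>
    intro d hd
    rw [map_mul, map_mul]
    revert hp
    refine Fin.lastCases ?_ (fun b => ?_) i
    · intro hp
      rw [bdr_last, map_zero, mul_zero, coeff_mul_X']
      simp [hd]
    · intro hp
      rw [bdr_cast, rename_X, coeff_mul_X', coeff_mul_X']
      split_ifs
      · apply hp
        simp [hd]
      · rfl

theorem bdr_all_zero (j : ℕ) : ∀ (p : MvPolynomial (Fin (m + 1)) ℝ)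
    (_ : ∀ k, bdr m ((pderiv (Fin.last m))^[k] p) = 0)
    (d : Fin (m + 1) →₀ ℕ) (_ : d (Fin.last m) = j), coeff d p = 0 := by
  induction j with
  | zero =>
    intro p h d hd
    have h0 := h 0
    simp only [Function.iterate_zero, id_eq] at h0
    rw [← coeff_ren_bdr p d hd, h0]; simp
  | succ j ih =>
    intro p h d hd
    obtain ⟨e, rfl⟩ : ∃ e, d = e + Finsupp.single (Fin.last m) 1 := by
      refine ⟨d - Finsupp.single (Fin.last m) 1, ?_⟩
      rw [Finsupp.sub_add_single_one_cancel]
      omega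
    have h1 := ih (pderiv (Fin.last m) p) (fun k => by
      have := h (k + 1)
      rwa [Function.iterate_succ_apply] at this) e (by simpa using hd)
    rw [coeff_pderiv] at h1
    rcases mul_eq_zero.1 h1 with h2 | h2
    · exact h2
    · have : (0:ℝ) ≤ e (Fin.last m) := by positivity
      linarith

theorem half_zero (p : MvPolynomial (Fin (m + 1)) ℝ)
    (h : ∀ x : Fin (m + 1) → ℝ, 0 ≤ x (Fin.last m) → eval x p = 0) : p = 0 := by
  apply funext_set (fun _ => Set.Ici (0 : ℝ)) (fun _ => Set.Ici_infinite 0)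
  intro x hx
  rw [h x (hx (Fin.last m) (Set.mem_univ _)), map_zero]

theorem linear_zero {n : ℕ} (p : MvPolynomial (Fin n) ℝ) (hd : p.totalDegree ≤ 1)
    (h0 : coeff 0 p = 0) (h1 : ∀ c, eval 0 (pderiv c p) = 0) : p = 0 := by
  ext d
  rw [coeff_zero]
  by_cases hz : d = 0
  · rw [hz, h0]
  obtain ⟨c, hc⟩ : ∃ c, d c ≠ 0 := by
    by_contra hcon
    push Not at hcon
    exact hz (Finsupp.ext hcon)
  obtain ⟨e, rfl⟩ : ∃ e, d = e + Finsupp.single c 1 :=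
    ⟨d - Finsupp.single c 1, (Finsupp.sub_add_single_one_cancel hc).symm⟩
  by_cases he : e = 0
  · subst he
    have h2 := h1 c
    have h3 : eval 0 (pderiv c p) = coeff 0 (pderiv c p) := by
      rw [← constantCoeff_eq]
      change eval (fun _ => 0) _ = _
      simp
    rw [h3, coeff_pderiv] at h2
    simpa using h2
  · have he' : e.degree ≠ 0 := fun h => he ((Finsupp.degree_eq_zero_iff e).1 h)
    apply coeff_eq_zero_of_totalDegree_lt
    refine lt_of_le_of_lt hd ?_
    change 1 < (e + Finsupp.single c 1).degree
    simp
    omega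

theorem iter_pderiv_comm (k : ℕ) (a b : Fin (m + 1)) (p : MvPolynomial (Fin (m + 1)) ℝ) :
    (pderiv b)^[k] (pderiv a p) = pderiv a ((pderiv b)^[k] p) := by
  induction k with
  | zero => rfl
  | succ k ih => rw [Function.iterate_succ_apply', Function.iterate_succ_apply', ih, pderiv_comm']

/-- `bdr ∘ ∂_n^k` as a linear map. -/
noncomputable def bdk (m k : ℕ) : MvPolynomial (Fin (m + 1)) ℝ →ₗ[ℝ] MvPolynomial (Fin m) ℝ :=
  (bdr m).toLinearMap ∘ₗ ((pderiv (Fin.last m)).toLinearMap ^ k)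

theorem bdk_apply (k : ℕ) (p : MvPolynomial (Fin (m + 1)) ℝ) :
    bdk m k p = bdr m ((pderiv (Fin.last m))^[k] p) := by
  simp [bdk, Module.End.pow_apply]

theorem bdk_C_mul (k : ℕ) (c : ℝ) (p : MvPolynomial (Fin (m + 1)) ℝ) :
    bdk m k (C c * p) = C c * bdk m k p := by
  rw [C_mul', C_mul', map_smul]

theorem bdk_pderiv (k : ℕ) (a : Fin m) (p : MvPolynomial (Fin (m + 1)) ℝ) :
    bdk m k (pderiv a.castSucc p) = pderiv a (bdk m k p) := by
  rw [bdk_apply, bdk_apply, iter_pderiv_comm, bdr_pderiv]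

theorem bdk_last (k : ℕ) (p : MvPolynomial (Fin (m + 1)) ℝ) :
    bdk m k (pderiv (Fin.last m) p) = bdk m (k + 1) p := by
  rw [bdk_apply, bdk_apply, Function.iterate_succ_apply]

theorem algSchouten_symm (n : ℕ) (H : Fin n → Fin n → MvPolynomial (Fin n) ℝ)
    (hs : ∀ i k, H i k = H k i) (i j : Fin n) : algSchouten n H i j = algSchouten n H j i := by
  unfold algSchouten
  have e1 : ∀ i j, ∑ m, pderiv m (pderiv j (H i m)) = ∑ m, pderiv j (pderiv m (H m i)) :=
    fun i j => Finset.sum_congr rfl fun m _ => by rw [pderiv_comm', hs i m]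
  rw [e1 i j, e1 j i, hs i j]
  simp only [eq_comm (a := i) (b := j)]
  ring

theorem all_bdk_zero (hm : 5 ≤ m)
    (H : Fin (m + 1) → Fin (m + 1) → MvPolynomial (Fin (m + 1)) ℝ)
    (hn : ∀ i, H i (Fin.last m) = 0) (hn' : ∀ i, H (Fin.last m) i = 0)
    (hZ : ∀ i j k l, algWeyl (m + 1) H i j k l = 0)
    (h0 : ∀ i j, bdk m 0 (H i j) = 0) (h1 : ∀ i j, bdk m 1 (H i j) = 0) :
    ∀ k, (∀ i j, bdk m k (H i j) = 0) ∧ (∀ i j, bdk m (k + 1) (H i j) = 0) := by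
  intro k
  induction k with
  | zero => exact ⟨h0, h1⟩
  | succ k ih =>
    refine ⟨ih.2, ?_⟩
    obtain ⟨ih0, ih1⟩ := ih
    have dz : ∀ (a : Fin m) (l i j : Fin (m + 1)),
        bdk m k (pderiv a.castSucc (pderiv l (H i j))) = 0 := by
      intro a l i j
      rw [bdk_pderiv]
      refine Fin.lastCases ?_ (fun b => ?_) l
      · rw [bdk_last, ih1, map_zero]
      · rw [bdk_pderiv, ih0]; simp
    have dz' : ∀ (a : Fin m) (l i j : Fin (m + 1)),
        bdk m k (pderiv l (pderiv a.castSucc (H i j))) = 0 := by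
      intro a l i j
      rw [pderiv_comm', dz]
    have dd : bdk m k (∑ r, ∑ p, pderiv r (pderiv p (H r p))) = 0 := by
      rw [map_sum]
      refine Finset.sum_eq_zero fun r _ => ?_
      rw [map_sum]
      refine Finset.sum_eq_zero fun p _ => ?_
      refine Fin.lastCases ?_ (fun b => ?_) r
      · rw [hn']; simp
      · rw [dz]
    have sn : bdk m k (algSchouten (m + 1) H (Fin.last m) (Fin.last m)) = 0 := by
      unfold algSchouten
      simp only [hn, hn', map_zero, Finset.sum_const_zero, map_sub, map_add, if_true, bdk_C_mul, dd]
      simp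
    intro i j
    refine Fin.lastCases ?_ (fun a => ?_) i
    · rw [hn', map_zero]
    refine Fin.lastCases ?_ (fun b => ?_) j
    · rw [hn, map_zero]
    have sab : bdk m k (algSchouten (m + 1) H a.castSucc b.castSucc) =
        - bdk m (k + 1 + 1) (H a.castSucc b.castSucc) := by
      unfold algSchouten
      simp only [map_sub, map_add, map_sum, bdk_C_mul, dz, dz', Finset.sum_const_zero]
      rw [Fin.sum_univ_castSucc]
      simp only [dz, Finset.sum_const_zero, bdk_last]
      have : bdk m k (if a.castSucc = b.castSucc then
          ∑ r, ∑ p, pderiv r (pderiv p (H r p)) else 0) = 0 := by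
        split_ifs
        · exact dd
        · simp
      rw [this]
      simp
    have hz := congrArg (bdk m k) (hZ a.castSucc (Fin.last m) b.castSucc (Fin.last m))
    unfold algWeyl at hz
    have ne1 : ∀ c : Fin m, c.castSucc ≠ Fin.last m := fun c => (Fin.castSucc_lt_last c).ne
    simp only [hn, hn', ne1, (ne1 _).symm, if_true, if_false, map_zero, map_add, map_sub,
      bdk_C_mul, bdk_last, sab] at hz
    have : bdk m k (if a.castSucc = b.castSucc then
        algSchouten (m + 1) H (Fin.last m) (Fin.last m) else 0) = 0 := by
      split_ifs
      · exact sn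
      · simp
    rw [this] at hz
    have hz2 : C (1 - (((m + 1 : ℕ) : ℝ) - 2)⁻¹) * bdk m (k + 1 + 1) (H a.castSucc b.castSucc) = 0 := by
      rw [map_sub, map_one]
      linear_combination hz
    rcases mul_eq_zero.1 hz2 with h | h
    · exfalso
      rw [C_eq_zero] at h
      have h5 : (5:ℝ) ≤ m := by exact_mod_cast hm
      have h6 : (((m + 1 : ℕ) : ℝ) - 2)⁻¹ < 1 := by
        apply inv_lt_one_of_one_lt₀
        push_cast
        linarith
      linarith
    · exact h

end WeylHelpers3

/-- If the symmetric trace-free tensor `H` of polynomials of degree at most `d = ⌊(n-2)/2⌋`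
has vanishing algebraic Weyl tensor on the closed upper half-space and vanishing normal
derivative on the boundary, then `H = 0` on the half-space. -/
theorem vanishing_of_algWeyl_eq_zero (n : ℕ) (hn : 3 ≤ n)
    (H : Fin n → Fin n → MvPolynomial (Fin n) ℝ)
    (hconst : ∀ i k : Fin n, MvPolynomial.coeff 0 (H i k) = 0)
    (hdeg : ∀ i k : Fin n, (H i k).totalDegree ≤ (n - 2) / 2)
    (hsymm : ∀ i k : Fin n, H i k = H k i)
    (htrace : (∑ i, H i i) = 0)
    (hfirst : ∀ a b c : Fin n, (a : ℕ) < n - 1 → (b : ℕ) < n - 1 → (c : ℕ) < n - 1 →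
      MvPolynomial.eval 0 (pderiv a (H b c)) = 0)
    (hnormal : ∀ i : Fin n, ∀ x : Fin n → ℝ, 0 ≤ x ⟨n - 1, by omega⟩ →
      MvPolynomial.eval x (H i ⟨n - 1, by omega⟩) = 0)
    (htang : ∀ b : Fin n, (b : ℕ) < n - 1 → ∀ x : Fin n → ℝ, x ⟨n - 1, by omega⟩ = 0 →
      (∑ a : Fin n, if (a : ℕ) < n - 1 then x a * MvPolynomial.eval x (H a b) else 0) = 0)
    (hZ : ∀ i j k l : Fin n, ∀ x : Fin n → ℝ, 0 ≤ x ⟨n - 1, by omega⟩ →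
      MvPolynomial.eval x (algWeyl n H i j k l) = 0)
    (hbdry : ∀ i j : Fin n, ∀ x : Fin n → ℝ, x ⟨n - 1, by omega⟩ = 0 →
      MvPolynomial.eval x (pderiv (⟨n - 1, by omega⟩ : Fin n) (H i j)) = 0) :
    ∀ i k : Fin n, ∀ x : Fin n → ℝ, 0 ≤ x ⟨n - 1, by omega⟩ →
      MvPolynomial.eval x (H i k) = 0 := by
  obtain ⟨m, rfl⟩ : ∃ m, n = m + 1 := ⟨n - 1, by omega⟩
  change ∀ i : Fin (m + 1), ∀ x : Fin (m + 1) → ℝ, 0 ≤ x (Fin.last m) →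
      eval x (H i (Fin.last m)) = 0 at hnormal
  change ∀ b : Fin (m + 1), (b : ℕ) < m → ∀ x : Fin (m + 1) → ℝ, x (Fin.last m) = 0 →
      (∑ a : Fin (m + 1), if (a : ℕ) < m then x a * eval x (H a b) else 0) = 0 at htang
  change ∀ i j k l : Fin (m + 1), ∀ x : Fin (m + 1) → ℝ, 0 ≤ x (Fin.last m) →
      eval x (algWeyl (m + 1) H i j k l) = 0 at hZ
  change ∀ i j : Fin (m + 1), ∀ x : Fin (m + 1) → ℝ, x (Fin.last m) = 0 →
      eval x (pderiv (Fin.last m) (H i j)) = 0 at hbdry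
  have hn0 : ∀ i, H i (Fin.last m) = 0 := fun i => half_zero _ (hnormal i)
  have hn0' : ∀ i, H (Fin.last m) i = 0 := fun i => by rw [hsymm, hn0]
  have hZ0 : ∀ i j k l, algWeyl (m + 1) H i j k l = 0 := fun i j k l => half_zero _ (hZ i j k l)
  suffices hH : ∀ i k, H i k = 0 by
    intro i k x _
    rw [hH, map_zero]
  by_cases hm : m < 5
  · intro i k
    have hd1 : (H i k).totalDegree ≤ 1 := (hdeg i k).trans (by omega)
    by_cases hi : i = Fin.last m
    · rw [hi, hn0']
    by_cases hk : k = Fin.last m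
    · rw [hk, hn0]
    apply linear_zero _ hd1 (hconst i k)
    intro c
    by_cases hc : c = Fin.last m
    · subst hc
      exact hbdry i k 0 rfl
    · exact hfirst c i k (Fin.val_lt_last hc) (Fin.val_lt_last hi) (Fin.val_lt_last hk)
  · have b0 : ∀ p, bdk m 0 p = bdr m p := fun p => by rw [bdk_apply]; rfl
    have hflat : ∀ a b : Fin m, bdr m (H a.castSucc b.castSucc) = 0 := by
      refine flat_vanish (by omega) (fun a b => bdr m (H a.castSucc b.castSucc))
        (fun a b => - (C ((((m + 1 : ℕ) : ℝ) - 2)⁻¹) *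
          bdr m (algSchouten (m + 1) H a.castSucc b.castSucc))) ?_ ?_ ?_ ?_ ?_ ?_
      · intro a b
        have h1 : coeff 0 (bdr m (H a.castSucc b.castSucc)) =
            eval 0 (bdr m (H a.castSucc b.castSucc)) := by
          rw [← constantCoeff_eq]
          change _ = eval (fun _ => 0) _
          simp
        have h2 : (Fin.snoc (α := fun _ => ℝ) (0 : Fin m → ℝ) 0 : Fin (m + 1) → ℝ) =
            fun _ => 0 := by
          funext i
          refine Fin.lastCases ?_ (fun b => ?_) i <;> simp
        have h3 := hconst a.castSucc b.castSucc
        rw [← constantCoeff_eq] at h3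
        rw [h1, eval_bdr, h2]
        simpa using h3
      · intro a b
        exact congrArg (bdr m) (hsymm _ _)
      · intro a b
        exact congrArg (fun q => - (C ((((m + 1 : ℕ) : ℝ) - 2)⁻¹) * bdr m q))
          (algSchouten_symm (m + 1) H hsymm _ _)
      · have := congrArg (bdr m) htrace
        rw [Fin.sum_univ_castSucc, hn0, add_zero, map_sum, map_zero] at this
        exact this
      · intro b
        apply MvPolynomial.funext
        intro y
        have := htang b.castSucc (by simp) (Fin.snoc (α := fun _ => ℝ) y 0) (by simp)
        rw [Fin.sum_univ_castSucc] at this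
        simp only [Fin.val_castSucc, Fin.is_lt, if_true, Fin.val_last, lt_irrefl, if_false,
          add_zero, Fin.snoc_castSucc] at this
        rw [map_sum, map_zero, ← this]
        simp only [map_mul, eval_X, eval_bdr]
      · intro a b c d
        have hz := congrArg (bdr m) (hZ0 a.castSucc b.castSucc c.castSucc d.castSucc)
        unfold algWeyl at hz
        have bite : ∀ (p : Prop) [Decidable p] (q : MvPolynomial (Fin (m + 1)) ℝ),
            bdr m (if p then q else 0) = if p then bdr m q else 0 := by
          intro p _ q
          split_ifs <;> simp
        simp only [map_add, map_sub, map_mul, bdr_pderiv, bdr_C, bite, Fin.castSucc_inj,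
          map_zero] at hz
        split_ifs at hz ⊢ <;> linear_combination hz
    have h0 : ∀ i j, bdk m 0 (H i j) = 0 := by
      intro i j
      rw [b0]
      refine Fin.lastCases ?_ (fun a => ?_) i
      · rw [hn0', map_zero]
      refine Fin.lastCases ?_ (fun b => ?_) j
      · rw [hn0, map_zero]
      exact hflat a b
    have h1 : ∀ i j, bdk m 1 (H i j) = 0 := by
      intro i j
      rw [bdk_apply]
      apply MvPolynomial.funext
      intro y
      rw [eval_bdr, map_zero]
      exact hbdry i j _ (by simp)
    have hall := all_bdk_zero (by omega) H hn0 hn0' hZ0 h0 h1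
    intro i j
    ext d
    rw [coeff_zero]
    exact bdr_all_zero _ (H i j) (fun k => by rw [← bdk_apply]; exact (hall k).1 i j) d rfl
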